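/- arXiv:0707.3425 — 4 statements merged into one kernel-verified Lean document; each statement's English description precedes it below -/
import Mathlib

section
/- Let α ∈ ℂ with α ≠ 0, c ∈ ℂ, b, d ∈ ℂ^{m−1}, and let A be an (m−1)×(m−1) complex matrix. Define f : ℂ × ℂ^{m−1} → ℂ × ℂ^{m−1} by f(w₁, w′) = ((w₁ + c + ⟨w′, b⟩)/α, (Aw′ + d)/α). Then for every integer n ≥ 2, the n-th iterate satisfies f_n(1, 0) = α^{−n} · (1 + β_{n−1}·c + ⟨p_{n−2}(A)d, b⟩, q_{n−1}(A)d), where β_j = Σ_{k=0}^j α^k, p_j(z) = Σ_{k=0}^j β_{j−k} z^k and q_j(z) = Σ_{k=0}^j α^{j−k} z^k, and p_j(A), q_j(A) denote these polynomials evaluated at the matrix A. Moreover f(1, 0) = α^{−1}·(1 + c, d). -/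
noncomputable section

/-- The standard Hermitian inner product, linear in the first argument and
conjugate-linear in the second. -/
def herm {ι : Type*} [Fintype ι] (z w : ι → ℂ) : ℂ := ∑ i, z i * (starRingEnd ℂ) (w i)

/-- `β_j = Σ_{k=0}^j α^k`. -/
def betaC (α : ℂ) (j : ℕ) : ℂ := ∑ k ∈ Finset.range (j + 1), α ^ k

/-- The matrix polynomial `p_j(A) = Σ_{k=0}^j β_{j-k} A^k`. -/
def pPoly (α : ℂ) {d : ℕ} (j : ℕ) (A : Matrix (Fin d) (Fin d) ℂ) : Matrix (Fin d) (Fin d) ℂ :=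
  ∑ k ∈ Finset.range (j + 1), betaC α (j - k) • A ^ k

/-- The matrix polynomial `q_j(A) = Σ_{k=0}^j α^{j-k} A^k`. -/
def qPoly (α : ℂ) {d : ℕ} (j : ℕ) (A : Matrix (Fin d) (Fin d) ℂ) : Matrix (Fin d) (Fin d) ℂ :=
  ∑ k ∈ Finset.range (j + 1), α ^ (j - k) • A ^ k

theorem herm_add_left {ι : Type*} [Fintype ι] (u v w : ι → ℂ) :
    herm (u + v) w = herm u w + herm v w := by
  simp [herm, add_mul, Finset.sum_add_distrib]

theorem herm_smul_left {ι : Type*} [Fintype ι] (a : ℂ) (v w : ι → ℂ) :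
    herm (a • v) w = a * herm v w := by
  simp [herm, Finset.mul_sum, mul_assoc]

theorem betaC_succ (α : ℂ) (j : ℕ) : betaC α (j + 1) = betaC α j + α ^ (j + 1) :=
  Finset.sum_range_succ _ _

theorem qPoly_succ (α : ℂ) {d : ℕ} (j : ℕ) (A : Matrix (Fin d) (Fin d) ℂ) :
    qPoly α (j + 1) A = A * qPoly α j A + α ^ (j + 1) • (1 : Matrix (Fin d) (Fin d) ℂ) := by
  unfold qPoly
  rw [Finset.sum_range_succ', Finset.mul_sum]
  simp [pow_succ']

theorem pPoly_succ (α : ℂ) {d : ℕ} (j : ℕ) (A : Matrix (Fin d) (Fin d) ℂ) :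
    pPoly α (j + 1) A = pPoly α j A + qPoly α (j + 1) A := by
  unfold pPoly qPoly
  rw [Finset.sum_range_succ, Finset.sum_range_succ _ (j + 1), ← add_assoc,
    ← Finset.sum_add_distrib]
  congr 1
  · refine Finset.sum_congr rfl fun k hk => ?_
    rw [Nat.sub_add_comm (Nat.lt_succ_iff.mp (Finset.mem_range.mp hk)), betaC_succ, add_smul]
  · simp [betaC]

theorem stmt9 {m : ℕ} (α : ℂ) (hα : α ≠ 0) (c : ℂ) (b d : Fin (m - 1) → ℂ)
    (A : Matrix (Fin (m - 1)) (Fin (m - 1)) ℂ)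
    (f : ℂ × (Fin (m - 1) → ℂ) → ℂ × (Fin (m - 1) → ℂ))
    (hf : ∀ w, f w = (α⁻¹ * (w.1 + c + herm w.2 b), α⁻¹ • (A.mulVec w.2 + d))) :
    (∀ n : ℕ, 2 ≤ n →
      f^[n] (1, 0) = (α ^ n)⁻¹ •
        ((1 + betaC α (n - 1) * c + herm ((pPoly α (n - 2) A).mulVec d) b,
          (qPoly α (n - 1) A).mulVec d) : ℂ × (Fin (m - 1) → ℂ))) ∧
    f (1, 0) = α⁻¹ • ((1 + c, d) : ℂ × (Fin (m - 1) → ℂ)) := by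
  have first : f (1, 0) = α⁻¹ • ((1 + c, d) : ℂ × (Fin (m - 1) → ℂ)) := by
    simp [hf, herm]
  refine ⟨fun n hn => ?_, first⟩
  induction n, hn using Nat.le_induction with
  | base =>
    rw [Function.iterate_succ_apply', Function.iterate_one, first, hf]
    simp only [Prod.smul_mk, Matrix.mulVec_smul, herm_smul_left, smul_eq_mul]
    ext i
    · simp [betaC, pPoly, Finset.sum_range_succ]
      field_simp
      ring
    · simp [qPoly, Finset.sum_range_succ, Matrix.add_mulVec, Matrix.smul_mulVec]
      field_simp
      ring
  | succ n hn ih =>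
    obtain ⟨j, rfl⟩ := Nat.exists_eq_add_of_le' hn
    have hj : j + 2 - 1 = j + 1 := rfl
    have hj' : j + 2 + 1 - 1 = j + 1 + 1 := rfl
    have hj'' : j + 2 + 1 - 2 = j + 1 := rfl
    rw [hj, Nat.add_sub_cancel] at ih
    rw [Function.iterate_succ_apply', ih, hf, hj', hj'', betaC_succ α (j + 1), pPoly_succ,
      qPoly_succ α (j + 1)]
    simp only [Prod.smul_mk, Matrix.mulVec_smul, herm_smul_left, smul_eq_mul,
      Matrix.add_mulVec, herm_add_left, Matrix.smul_mulVec, Matrix.one_mulVec,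
      ← Matrix.mulVec_mulVec]
    ext i
    · simp only
      field_simp
      ring
    · simp only [Pi.smul_apply, Pi.add_apply, smul_eq_mul]
      field_simp
      ring
end
end

section
/- Let 0 < α < 1, c ∈ ℂ, b, d ∈ ℂ^{m−1}, let A be an (m−1)×(m−1) complex matrix with I − A invertible, and define f(w₁, w′) = ((w₁ + c + ⟨w′, b⟩)/α, (Aw′ + d)/α). Suppose f maps the closed Siegel half-space {(w₁, w′) : Re w₁ ≥ ‖w′‖²} into itself. Then, with u = (I−A)^{−1}d, one has Re⟨u, b⟩ + Re c ≥ ((1−α)/α)·‖u‖² ≥ 0; consequently the number x = 1 + (1/(1−α))·(c + ⟨(I−A)^{−1}d, b⟩) satisfies Re x ≥ 1. -/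
noncomputable section

theorem stmt12 {m : ℕ} (α : ℝ) (hα0 : 0 < α) (hα1 : α < 1) (c : ℂ)
    (b d : EuclideanSpace ℂ (Fin (m - 1)))
    (A : Matrix (Fin (m - 1)) (Fin (m - 1)) ℂ) (hA : IsUnit (1 - A))
    (f : ℂ × EuclideanSpace ℂ (Fin (m - 1)) → ℂ × EuclideanSpace ℂ (Fin (m - 1)))
    (hf : ∀ w, f w = (((α : ℂ))⁻¹ * (w.1 + c + herm w.2 b),
      ((α : ℂ))⁻¹ • ((WithLp.equiv 2 (Fin (m - 1) → ℂ)).symm (A.mulVec w.2) + d)))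
    -- `f` maps the closed Siegel half-space into itself
    (hmap : ∀ w : ℂ × EuclideanSpace ℂ (Fin (m - 1)),
      ‖w.2‖ ^ 2 ≤ w.1.re → ‖(f w).2‖ ^ 2 ≤ (f w).1.re)
    (u : EuclideanSpace ℂ (Fin (m - 1)))
    (hu : u = (WithLp.equiv 2 (Fin (m - 1) → ℂ)).symm ((1 - A)⁻¹.mulVec d)) :
    (herm u b).re + c.re ≥ ((1 - α) / α) * ‖u‖ ^ 2 ∧
    ((1 - α) / α) * ‖u‖ ^ 2 ≥ 0 ∧
    (1 + (1 / (1 - (α : ℂ))) * (c + herm u b)).re ≥ 1 := by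
  have h1α : 0 < 1 - α := by linarith
  have hfix : (WithLp.equiv 2 (Fin (m - 1) → ℂ)).symm (A.mulVec u) + d = u := by
    have hinv : (1 - A).mulVec u = d := by
      rw [hu]
      change (1 - A).mulVec ((1 - A)⁻¹.mulVec d) = d
      rw [Matrix.mulVec_mulVec, Matrix.mul_nonsing_inv _ ((Matrix.isUnit_iff_isUnit_det _).1 hA),
        Matrix.one_mulVec]
    ext i
    have hi := congrFun hinv i
    rw [Matrix.sub_mulVec, Matrix.one_mulVec, Pi.sub_apply] at hi
    change A.mulVec u i + d i = u i
    rw [← hi]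
    ring
  have hbase := hmap (((‖u‖ ^ 2 : ℝ) : ℂ), u) (by rw [Complex.ofReal_re])
  rw [hf] at hbase
  dsimp only at hbase
  rw [hfix, norm_smul, norm_inv, Complex.norm_real, Real.norm_of_nonneg hα0.le,
    ← Complex.ofReal_inv, Complex.re_ofReal_mul, Complex.add_re, Complex.add_re,
    Complex.ofReal_re] at hbase
  have hnonneg : 0 ≤ (1 - α) / α * ‖u‖ ^ 2 := by positivity
  have hmain : (1 - α) / α * ‖u‖ ^ 2 ≤ (herm u b).re + c.re := by
    have hscaled := mul_le_mul_of_nonneg_left hbase hα0.le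
    have hl : α * (α⁻¹ * ‖u‖) ^ 2 = (1 - α) / α * ‖u‖ ^ 2 + ‖u‖ ^ 2 := by
      field_simp
      ring
    rw [hl, mul_inv_cancel_left₀ hα0.ne'] at hscaled
    linarith
  refine ⟨hmain, hnonneg, ?_⟩
  have hcast : 1 / (1 - (α : ℂ)) = ((1 / (1 - α) : ℝ) : ℂ) := by push_cast; rfl
  rw [hcast, Complex.add_re, Complex.re_ofReal_mul, Complex.one_re, Complex.add_re]
  have : 0 ≤ 1 / (1 - α) * (c.re + (herm u b).re) :=
    mul_nonneg (by positivity) (by linarith)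
  linarith
end
end

section
/- Let φ : 𝔹^m → 𝔹^m and let ζ ∈ ℂ^m with |ζ| = 1. Suppose the iterates satisfy φ_n(0) → ζ as n → ∞, and that liminf_{z → ζ, z ∈ 𝔹^m} (1 − |φ(z)|²)/(1 − |z|²) ≥ 1 (i.e., the dilatation coefficient of φ is 1, the parabolic case). Then lim_{n→∞} (1 − |φ_n(0)|)^{1/n} = 1. -/
/-- A real function is eventually above every nonnegative number below its liminf. -/
theorem eventually_le_of_lt_real_liminf {α : Type*} {l : Filter α} {f : α → ℝ} {c : ℝ}
    (hc : 0 ≤ c) (h : c < Filter.liminf f l) : ∀ᶠ x in l, c ≤ f x := by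
  rw [Filter.liminf_eq] at h
  have hne : {a : ℝ | ∀ᶠ x in l, a ≤ f x}.Nonempty := by
    by_contra hempty
    rw [Set.not_nonempty_iff_eq_empty] at hempty
    rw [hempty, Real.sSup_empty] at h
    linarith
  obtain ⟨a, ha, hca⟩ := exists_lt_of_lt_csSup hne h
  filter_upwards [ha] with x hx
  exact hca.le.trans hx

/-- A positive sequence with eventual ratio at least `c` decays at most geometrically. -/
theorem exists_pos_mul_pow_le_of_eventually_mul_le {a : ℕ → ℝ} {c : ℝ} (ha : ∀ n, 0 < a n)
    (hc : 0 < c) (h : ∀ᶠ n in Filter.atTop, c * a n ≤ a (n + 1)) :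
    ∃ K > 0, ∀ᶠ n in Filter.atTop, K * c ^ n ≤ a n := by
  obtain ⟨N, hN⟩ := Filter.eventually_atTop.1 h
  refine ⟨a N / c ^ N, div_pos (ha N) (pow_pos hc N), ?_⟩
  filter_upwards [Filter.eventually_ge_atTop N] with n hn
  induction n, hn using Nat.le_induction with
  | base => rw [div_mul_cancel₀ _ (pow_pos hc N).ne']
  | succ n hn ih =>
    calc a N / c ^ N * c ^ (n + 1) = c * (a N / c ^ N * c ^ n) := by ring
      _ ≤ c * a n := mul_le_mul_of_nonneg_left ih hc.le
      _ ≤ a (n + 1) := hN n hn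

/-- If a sequence in `[0, 1]` decays more slowly than any geometric sequence, its `n`-th roots
tend to one. -/
theorem tendsto_rpow_inv_nat_one_of_subexponential {b : ℕ → ℝ} (hb0 : ∀ n, 0 ≤ b n)
    (hb1 : ∀ n, b n ≤ 1)
    (h : ∀ c : ℝ, 0 < c → c < 1 → ∃ K > 0, ∀ᶠ n in Filter.atTop, K * c ^ n ≤ b n) :
    Filter.Tendsto (fun n : ℕ => b n ^ ((n : ℝ)⁻¹)) Filter.atTop (nhds 1) := by
  refine tendsto_order.2 ⟨fun d hd => ?_, fun d hd => Filter.Eventually.of_forall fun n =>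
    (Real.rpow_le_one (hb0 n) (hb1 n) (by positivity)).trans_lt hd⟩
  obtain ⟨c, hdc, hc1⟩ := exists_between (max_lt hd one_pos)
  have hc0 : 0 < c := (le_max_right _ _).trans_lt hdc
  obtain ⟨K, hK, hKb⟩ := h c hc0 hc1
  have hroot : Filter.Tendsto (fun n : ℕ => K ^ ((n : ℝ)⁻¹) * c) Filter.atTop (nhds c) := by
    have := (tendsto_const_nhds (x := K)).rpow (tendsto_inv_atTop_nhds_zero_nat (𝕜 := ℝ))
      (Or.inl hK.ne')
    simpa using this.mul_const c
  filter_upwards [hKb, hroot.eventually_const_lt ((le_max_left _ _).trans_lt hdc),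
    Filter.eventually_ne_atTop 0] with n hn hdn hn0
  calc d < K ^ ((n : ℝ)⁻¹) * c := hdn
    _ = (K * c ^ n) ^ ((n : ℝ)⁻¹) := by
      rw [Real.mul_rpow hK.le (pow_nonneg hc0.le n), Real.pow_rpow_inv_natCast hc0.le hn0]
    _ ≤ b n ^ ((n : ℝ)⁻¹) := Real.rpow_le_rpow (by positivity) hn (by positivity)

theorem stmt16 {m : ℕ} (φ : EuclideanSpace ℂ (Fin m) → EuclideanSpace ℂ (Fin m))
    (hmap : ∀ z, ‖z‖ < 1 → ‖φ z‖ < 1)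
    (ζ : EuclideanSpace ℂ (Fin m)) (hζ : ‖ζ‖ = 1)
    (horb : Filter.Tendsto (fun n : ℕ => φ^[n] 0) Filter.atTop (nhds ζ))
    (hliminf : 1 ≤ Filter.liminf (fun z => (1 - ‖φ z‖ ^ 2) / (1 - ‖z‖ ^ 2))
      (nhdsWithin ζ (Metric.ball 0 1))) :
    Filter.Tendsto (fun n : ℕ => (1 - ‖φ^[n] 0‖) ^ ((n : ℝ)⁻¹))
      Filter.atTop (nhds 1) := by
  have hball : ∀ n : ℕ, ‖φ^[n] 0‖ < 1 := by
    intro n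
    induction n with
    | zero => simp
    | succ n ih => rw [Function.iterate_succ_apply']; exact hmap _ ih
  have hpos : ∀ n : ℕ, 0 < 1 - ‖φ^[n] 0‖ ^ 2 := fun n => by
    nlinarith [hball n, norm_nonneg (φ^[n] 0)]
  have horb' : Filter.Tendsto (fun n : ℕ => φ^[n] 0) Filter.atTop
      (nhdsWithin ζ (Metric.ball 0 1)) :=
    tendsto_nhdsWithin_iff.2 ⟨horb, Filter.Eventually.of_forall fun n => by simpa using hball n⟩
  refine tendsto_rpow_inv_nat_one_of_subexponential (fun n => (sub_pos.2 (hball n)).le)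
    (fun n => sub_le_self _ (norm_nonneg _)) fun c hc0 hc1 => ?_
  obtain ⟨K, hK, hKa⟩ := exists_pos_mul_pow_le_of_eventually_mul_le hpos hc0 (by
    filter_upwards [horb'.eventually
      (eventually_le_of_lt_real_liminf hc0.le (hc1.trans_le hliminf))] with n hn
    rw [Function.iterate_succ_apply']
    exact (le_div_iff₀ (hpos n)).1 hn)
  refine ⟨K / 2, half_pos hK, ?_⟩
  filter_upwards [hKa] with n hn
  nlinarith [sq_nonneg (1 - ‖φ^[n] 0‖)]
end

section
/- Let 0 < α < 1, c ∈ ℂ, b, d ∈ ℂ^{m−1}, let A be an (m−1)×(m−1) complex matrix with operator norm ‖A‖ ≤ √α, and define f(w₁, w′) = ((w₁ + c + ⟨w′, b⟩)/α, (Aw′ + d)/α). Suppose f maps the open Siegel half-space ℍ^m = {Re w₁ > ‖w′‖²} into itself and maps its closure {Re w₁ ≥ ‖w′‖²} into itself, and write (u_n, v_n) = f_n(1, 0) for the n-th iterate. If lim_{n→∞} ‖v_n‖²/(Re u_n) = 0, then lim_{n→∞} α^n·‖v_n‖² = 0 (equivalently, ‖q_{n−1}(A)d‖² = o(α^n) as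 n → ∞, where q_j(z) = Σ_{k=0}^j α^{j−k} z^k). -/
noncomputable section

theorem norm_herm_le {ι : Type*} [Fintype ι] (z w : EuclideanSpace ℂ ι) :
    ‖herm z w‖ ≤ ‖z‖ * ‖w‖ := by
  have h : herm z w = inner ℂ w z := by
    simp [herm, PiLp.inner_apply]
  rw [h, mul_comm]
  exact norm_inner_le_norm w z

/-- A sequence whose increments are dominated by a geometric sequence is bounded above. -/
theorem le_add_div_of_succ_le_add_geometric {t P : ℝ} (ht0 : 0 ≤ t) (ht1 : t < 1) (hP : 0 ≤ P)
    {a : ℕ → ℝ} (ha : ∀ n, a (n + 1) ≤ a n + t ^ n * P) (n : ℕ) :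
    a n ≤ a 0 + P / (1 - t) := by
  have h1 : 0 < 1 - t := sub_pos.2 ht1
  have key : a n ≤ a 0 + P / (1 - t) * (1 - t ^ n) := by
    induction n with
    | zero => simp
    | succ k ih =>
      have e : P / (1 - t) * (1 - t ^ (k + 1)) = P / (1 - t) * (1 - t ^ k) + t ^ k * P := by
        field_simp
        ring
      linarith [ha k]
  have h2 : 0 ≤ P / (1 - t) * t ^ n := by positivity
  linarith

theorem stmt18 {m : ℕ} (α : ℝ) (hα0 : 0 < α) (hα1 : α < 1) (c : ℂ)
    (b d : EuclideanSpace ℂ (Fin (m - 1)))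
    (A : Matrix (Fin (m - 1)) (Fin (m - 1)) ℂ)
    (hA : ‖Matrix.toEuclideanCLM (𝕜 := ℂ) A‖ ≤ Real.sqrt α)
    (f : ℂ × EuclideanSpace ℂ (Fin (m - 1)) → ℂ × EuclideanSpace ℂ (Fin (m - 1)))
    (hf : ∀ w, f w = (((α : ℂ))⁻¹ * (w.1 + c + herm w.2 b),
      ((α : ℂ))⁻¹ • ((WithLp.equiv 2 (Fin (m - 1) → ℂ)).symm (A.mulVec w.2) + d)))
    -- `f` maps the open Siegel half-space into itself
    (hmapo : ∀ w : ℂ × EuclideanSpace ℂ (Fin (m - 1)),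
      ‖w.2‖ ^ 2 < w.1.re → ‖(f w).2‖ ^ 2 < (f w).1.re)
    -- `f` maps the closed Siegel half-space into itself
    (hmapc : ∀ w : ℂ × EuclideanSpace ℂ (Fin (m - 1)),
      ‖w.2‖ ^ 2 ≤ w.1.re → ‖(f w).2‖ ^ 2 ≤ (f w).1.re)
    (u : ℕ → ℂ) (v : ℕ → EuclideanSpace ℂ (Fin (m - 1)))
    (huv : ∀ n, (u n, v n) = f^[n] (1, 0))
    (hrestr : Filter.Tendsto (fun n : ℕ => ‖v n‖ ^ 2 / (u n).re) Filter.atTop (nhds 0)) :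
    Filter.Tendsto (fun n : ℕ => α ^ n * ‖v n‖ ^ 2) Filter.atTop (nhds 0) := by
  obtain ⟨t, ht⟩ : ∃ t, t = Real.sqrt α := ⟨_, rfl⟩
  have ht0 : 0 < t := ht ▸ Real.sqrt_pos.2 hα0
  have htα : α = t ^ 2 := by rw [ht, Real.sq_sqrt hα0.le]
  have ht1 : t < 1 := by nlinarith
  rw [← ht] at hA
  have hstep : ∀ n, (u (n + 1), v (n + 1)) = f (u n, v n) := fun n => by
    rw [huv, huv, Function.iterate_succ_apply']
  have h0 : (u 0, v 0) = ((1 : ℂ), (0 : EuclideanSpace ℂ (Fin (m - 1)))) := huv 0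
  have hu0 : u 0 = 1 := congrArg Prod.fst h0
  have hv0 : v 0 = 0 := congrArg Prod.snd h0
  have hpos : ∀ n, ‖v n‖ ^ 2 < (u n).re := fun n => by
    induction n with
    | zero => simp [hu0, hv0]
    | succ k ih =>
      have h := hmapo (u k, v k) ih
      rwa [← hstep] at h
  have hv : ∀ n, ‖v (n + 1)‖ ≤ α⁻¹ * (t * ‖v n‖ + ‖d‖) := fun n => by
    have h := congrArg Prod.snd ((hstep n).trans (hf _))
    dsimp only at h
    rw [h, norm_smul, norm_inv, Complex.norm_real, Real.norm_of_nonneg hα0.le]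
    gcongr
    exact (norm_add_le _ _).trans (add_le_add_left
      ((Matrix.toEuclideanCLM (𝕜 := ℂ) A).le_of_opNorm_le hA (v n)) _)
  have hu : ∀ n, (u (n + 1)).re ≤ α⁻¹ * ((u n).re + ‖c‖ + ‖v n‖ * ‖b‖) := fun n => by
    have h := congrArg Prod.fst ((hstep n).trans (hf _))
    dsimp only at h
    rw [h, ← Complex.ofReal_inv, Complex.re_ofReal_mul, Complex.add_re, Complex.add_re]
    gcongr
    · exact Complex.re_le_norm c
    · exact (Complex.re_le_norm _).trans (norm_herm_le _ _)
  have hvb : ∀ n, t ^ n * ‖v n‖ ≤ ‖d‖ / t / (1 - t) := fun n => by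
    have h := le_add_div_of_succ_le_add_geometric (a := fun n => t ^ n * ‖v n‖) ht0.le ht1
      (P := ‖d‖ / t) (by positivity) (fun n => ?_) n
    · simpa [hv0] using h
    · calc t ^ (n + 1) * ‖v (n + 1)‖ ≤ t ^ (n + 1) * (α⁻¹ * (t * ‖v n‖ + ‖d‖)) := by
            gcongr
            exact hv n
        _ = t ^ n * ‖v n‖ + t ^ n * (‖d‖ / t) := by
            rw [htα]
            field_simp
            ring
  set K := ‖d‖ / t / (1 - t)
  have hK0 : 0 ≤ K := le_trans (by positivity) (hvb 0)
  have hub : ∀ n, α ^ n * (u n).re ≤ 1 + (‖c‖ + K * ‖b‖) / (1 - t) := fun n => by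
    have h := le_add_div_of_succ_le_add_geometric (a := fun n => α ^ n * (u n).re) ht0.le ht1
      (P := ‖c‖ + K * ‖b‖) (by positivity) (fun n => ?_) n
    · simpa [hu0] using h
    · have hαt : α ^ n = t ^ n * t ^ n := by rw [htα]; ring
      have htn : t ^ n ≤ 1 := pow_le_one₀ ht0.le ht1.le
      calc α ^ (n + 1) * (u (n + 1)).re
          ≤ α ^ (n + 1) * (α⁻¹ * ((u n).re + ‖c‖ + ‖v n‖ * ‖b‖)) := by
            gcongr
            exact hu n
        _ = α ^ n * (u n).re + α ^ n * (‖c‖ + ‖v n‖ * ‖b‖) := by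
            field_simp
            ring
        _ = α ^ n * (u n).re + t ^ n * (t ^ n * ‖c‖ + (t ^ n * ‖v n‖) * ‖b‖) := by
            rw [hαt]
            ring
        _ ≤ α ^ n * (u n).re + t ^ n * (1 * ‖c‖ + K * ‖b‖) := by
            gcongr
            exact hvb n
        _ = α ^ n * (u n).re + t ^ n * (‖c‖ + K * ‖b‖) := by rw [one_mul]
  refine squeeze_zero (fun n => by positivity) (fun n => ?_)
    (by simpa using hrestr.mul_const (1 + (‖c‖ + K * ‖b‖) / (1 - t)))
  have hn : 0 < (u n).re := (sq_nonneg _).trans_lt (hpos n)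
  calc α ^ n * ‖v n‖ ^ 2 = ‖v n‖ ^ 2 / (u n).re * (α ^ n * (u n).re) := by
        field_simp
    _ ≤ _ := by
        gcongr
        exact hub n
end
end
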